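/- arXiv:1706.02756 — 2 statements merged into one kernel-verified Lean document; each statement's English description precedes it below -/
import Mathlib

section
/- Let G be a finite group and ρ a nontrivial irreducible finite-dimensional complex representation of G with α(ρ) > 1. Then there exists a prime factor p of |G| such that for every Sylow p-subgroup P of G, the operator ∑_{g∈P} ρ(g) is the zero operator. -/
namespace AlphaChar

variable {G : Type*} [Group G] {V : Type*} [AddCommMonoid V] [Module ℂ V]

/-- The cardinality of the orbit of a vector `v` under the linear action of `G` via `ρ`. -/
noncomputable def orbitCard (ρ : Representation ℂ G V) (v : V) : ℕ :=
  Nat.card (Set.range fun g : G => ρ g v)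

open Classical in
/-- The α-characteristic of a representation: the gcd of the cardinalities of the orbits
of all nonzero vectors. -/
noncomputable def alphaChar [Finite G] (ρ : Representation ℂ G V) : ℕ :=
  ((Finset.range (Nat.card G + 1)).filter
    (fun n => ∃ v : V, v ≠ 0 ∧ orbitCard ρ v = n)).gcd id

/-- A representation is nontrivial if some group element acts as a non-identity operator. -/
def IsNontrivial (ρ : Representation ℂ G V) : Prop := ∃ g : G, ρ g ≠ 1

/-- A representation is irreducible if the space is nonzero and the only invariant
subspaces are `⊥` and `⊤`. -/
def IsIrreducible (ρ : Representation ℂ G V) : Prop :=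
  Nontrivial V ∧
    ∀ U : Submodule ℂ V, (∀ (g : G) (v : V), v ∈ U → ρ g v ∈ U) → U = ⊥ ∨ U = ⊤

end AlphaChar

namespace AlphaChar

/-- The orbit of `v` has cardinality the index of its stabilizer, so that cardinality divides the
index of every subgroup fixing `v`. -/
theorem orbitCard_dvd_index {G : Type*} [Group G] {V : Type*} [AddCommMonoid V] [Module ℂ V]
    (ρ : Representation ℂ G V) (v : V) (H : Subgroup G) (hH : ∀ g ∈ H, ρ g v = v) :
    orbitCard ρ v ∣ H.index := by
  let _ : MulAction G V := MulAction.compHom V ρ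
  have hle : H ≤ MulAction.stabilizer G v := fun g hg => hH g hg
  have hcard : orbitCard ρ v = (MulAction.stabilizer G v).index := by
    rw [MulAction.index_stabilizer]
    rfl
  rw [hcard]
  exact Subgroup.index_dvd_of_le hle

theorem orbitCard_dvd_card {G : Type*} [Group G] {V : Type*} [AddCommMonoid V] [Module ℂ V]
    (ρ : Representation ℂ G V) (v : V) : orbitCard ρ v ∣ Nat.card G := by
  simpa using orbitCard_dvd_index ρ v ⊥ (by simp)

theorem alphaChar_dvd_orbitCard {G : Type*} [Group G] [Finite G] {V : Type*} [AddCommMonoid V]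
    [Module ℂ V] (ρ : Representation ℂ G V) {v : V} (hv : v ≠ 0) :
    alphaChar ρ ∣ orbitCard ρ v := by
  classical
  refine Finset.gcd_dvd (f := id) (Finset.mem_filter.2 ⟨Finset.mem_range.2 ?_, v, hv, rfl⟩)
  exact Nat.lt_succ_of_le (Nat.le_of_dvd Nat.card_pos (orbitCard_dvd_card ρ v))

theorem apply_finsum_subgroup_apply {G : Type*} [Group G] [Finite G] {V : Type*} [AddCommMonoid V]
    [Module ℂ V] (ρ : Representation ℂ G V) (H : Subgroup G) {g : G} (hg : g ∈ H) (w : V) :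
    ρ g ((∑ᶠ h : H, ρ (h : G)) w) = (∑ᶠ h : H, ρ (h : G)) w := by
  cases nonempty_fintype H
  simp only [finsum_eq_sum_of_fintype, LinearMap.sum_apply, map_sum]
  refine Fintype.sum_equiv (Equiv.mulLeft (⟨g, hg⟩ : H)) _ _ fun h => ?_
  simp

end AlphaChar

open AlphaChar in
/-- if ρ is nontrivial irreducible with α(ρ) > 1, then for some prime
factor p of |G|, the sum of ρ(g) over any Sylow p-subgroup is the zero operator. -/
theorem exists_prime_sylow_sum_eq_zero {G : Type} [Group G] [Finite G]
    {V : Type} [AddCommGroup V] [Module ℂ V] [FiniteDimensional ℂ V]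
    (ρ : Representation ℂ G V) (hnt : IsNontrivial ρ) (hirr : IsIrreducible ρ)
    (hα : 1 < alphaChar ρ) :
    ∃ p : ℕ, p.Prime ∧ p ∣ Nat.card G ∧
      ∀ P : Sylow p G, ∑ᶠ g : ↥(P : Subgroup G), ρ (g : G) = 0 := by
  obtain ⟨p, hp, hpα⟩ := Nat.exists_prime_and_dvd hα.ne'
  have : Fact p.Prime := ⟨hp⟩
  have := hirr.1
  obtain ⟨v, hv⟩ := exists_ne (0 : V)
  refine ⟨p, hp, (hpα.trans (alphaChar_dvd_orbitCard ρ hv)).trans (orbitCard_dvd_card ρ v),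
    fun P => LinearMap.ext fun w => ?_⟩
  by_contra hw
  exact P.not_dvd_index <| (hpα.trans (alphaChar_dvd_orbitCard ρ hw)).trans <|
    orbitCard_dvd_index ρ _ P fun g hg => apply_finsum_subgroup_apply ρ P hg w
end

section
/- Let G be a finite group and H a proper subgroup of G. Let V be the augmentation module of the action of G on the coset space G/H by left translation. Then α(V) > 1 if and only if the index [G:H] is a prime power. Moreover, if [G:H] is a power of a prime p, then p divides α(V). -/
namespace AlphaChar

/-- The complex permutation representation associated with an action of `G` on `X`:
`(g · f) x = f (g⁻¹ • x)` on functions `f : X → ℂ`. -/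
def permRep (G : Type*) [Group G] (X : Type*) [MulAction G X] :
    Representation ℂ G (X → ℂ) where
  toFun g :=
    { toFun := fun f x => f (g⁻¹ • x)
      map_add' := by intro a b; rfl
      map_smul' := by intro c f; rfl }
  map_one' := by ext f x; simp
  map_mul' := by intro a b; ext f x; simp [mul_smul]

/-- The augmentation submodule: functions on `X` whose values sum to zero. -/
noncomputable def augSubmodule (X : Type*) [Finite X] : Submodule ℂ (X → ℂ) where
  carrier := {f | ∑ᶠ x : X, f x = 0}
  zero_mem' := by simp
  add_mem' := by
    intro a b ha hb
    simp only [Set.mem_setOf_eq, Pi.add_apply] at *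
    rw [finsum_add_distrib (Set.toFinite _) (Set.toFinite _), ha, hb, add_zero]
  smul_mem' := by
    intro c f hf
    simp only [Set.mem_setOf_eq, Pi.smul_apply, smul_eq_mul] at *
    have h := smul_finsum' (M := ℂ) c (f := f) (Set.toFinite _)
    rw [hf, smul_zero] at h
    simpa [smul_eq_mul] using h.symm

lemma permRep_mem_augSubmodule {G : Type*} [Group G] {X : Type*} [MulAction G X]
    [Finite X] (g : G) (f : X → ℂ) (hf : f ∈ augSubmodule X) :
    permRep G X g f ∈ augSubmodule X := by
  have hf' : ∑ᶠ x : X, f x = 0 := hf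
  show ∑ᶠ x : X, f (g⁻¹ • x) = 0
  exact (finsum_comp_equiv (MulAction.toPerm (g⁻¹ : G)) (f := f)).trans hf'

/-- The augmentation representation of `G` associated with its action on `X`. -/
noncomputable def augRep (G : Type*) [Group G] (X : Type*) [MulAction G X] [Finite X] :
    Representation ℂ G ↥(augSubmodule X) where
  toFun g :=
    { toFun := fun f => ⟨permRep G X g f.1, permRep_mem_augSubmodule g f.1 f.2⟩
      map_add' := by intro a b; ext x; simp [permRep]
      map_smul' := by intro c f; ext x; simp [permRep] }
  map_one' := by ext f x; simp [permRep]
  map_mul' := by intro a b; ext f x; simp [permRep, mul_smul]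

end AlphaChar

namespace AlphaChar

/-- The group elements fixing a vector form a subgroup whose index is the cardinality of the
orbit of that vector. -/
lemma exists_subgroup_index_eq_orbitCard {G V : Type*} [Group G] [AddCommMonoid V] [Module ℂ V]
    (ρ : Representation ℂ G V) (v : V) :
    ∃ K : Subgroup G, (∀ g, g ∈ K ↔ ρ g v = v) ∧ orbitCard ρ v = K.index := by
  let : MulAction G V := MulAction.compHom V ρ
  refine ⟨MulAction.stabilizer G v, fun g => Iff.rfl, ?_⟩
  rw [MulAction.index_stabilizer]
  rfl

lemma orbitCard_pos {G V : Type*} [Group G] [Finite G] [AddCommMonoid V] [Module ℂ V]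
    (ρ : Representation ℂ G V) (v : V) : 0 < orbitCard ρ v := by
  obtain ⟨K, -, h⟩ := exists_subgroup_index_eq_orbitCard ρ v
  rw [h]
  exact Nat.pos_of_ne_zero K.index_ne_zero_of_finite

lemma dvd_alphaChar_iff {G V : Type*} [Group G] [Finite G] [AddCommMonoid V] [Module ℂ V]
    (ρ : Representation ℂ G V) (d : ℕ) :
    d ∣ alphaChar ρ ↔ ∀ v : V, v ≠ 0 → d ∣ orbitCard ρ v := by
  classical
  simp only [alphaChar, Finset.dvd_gcd_iff, Finset.mem_filter, Finset.mem_range, id]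
  constructor
  · intro h v hv
    refine h _ ⟨Nat.lt_succ_of_le ?_, v, hv, rfl⟩
    obtain ⟨K, -, hK⟩ := exists_subgroup_index_eq_orbitCard ρ v
    rw [hK]
    exact Nat.le_of_dvd Nat.card_pos K.index_dvd_card
  · rintro h _ ⟨-, v, hv, rfl⟩
    exact h v hv

lemma alphaChar_ne_zero {G V : Type*} [Group G] [Finite G] [AddCommMonoid V] [Module ℂ V]
    [Nontrivial V] (ρ : Representation ℂ G V) : alphaChar ρ ≠ 0 := by
  intro h
  obtain ⟨v, hv⟩ := exists_ne (0 : V)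
  have h0 := (dvd_alphaChar_iff ρ 0).1 (by rw [h]) v hv
  exact (orbitCard_pos ρ v).ne' (Nat.eq_zero_of_zero_dvd h0)

lemma augRep_apply {G X : Type*} [Group G] [MulAction G X] [Finite X] (g : G)
    (f : augSubmodule X) (x : X) : (augRep G X g f).1 x = f.1 (g⁻¹ • x) := rfl

lemma mem_augSubmodule {X : Type*} [Fintype X] (f : X → ℂ) :
    f ∈ augSubmodule X ↔ ∑ x, f x = 0 := by
  rw [← finsum_eq_sum_of_fintype]
  rfl

/-- A subgroup acting transitively fixes no nonzero vector of the augmentation module. -/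
lemma eq_zero_of_isPretransitive {G X : Type*} [Group G] [MulAction G X] [Finite X]
    (K : Subgroup G) [MulAction.IsPretransitive K X] (f : augSubmodule X)
    (hf : ∀ g ∈ K, augRep G X g f = f) : f = 0 := by
  have : Fintype X := Fintype.ofFinite X
  ext x
  have hconst : ∀ y, f.1 y = f.1 x := by
    intro y
    obtain ⟨k, rfl⟩ := MulAction.exists_smul_eq K x y
    have h := congrArg (fun f : augSubmodule X => f.1 (k • x)) (hf k k.2)
    simp only [augRep_apply, Subgroup.smul_def, inv_smul_smul] at h
    exact h.symm
  have hsum := (mem_augSubmodule f.1).1 f.2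
  have : Nonempty X := ⟨x⟩
  simpa [hconst] using hsum

/-- A subgroup acting intransitively fixes a nonzero vector of the augmentation module. -/
lemma exists_fixed_of_not_isPretransitive {G X : Type*} [Group G] [MulAction G X] [Finite X]
    (K : Subgroup G) (hK : ¬ MulAction.IsPretransitive K X) :
    ∃ f : augSubmodule X, f ≠ 0 ∧ ∀ g ∈ K, augRep G X g f = f := by
  classical
  have : Fintype X := Fintype.ofFinite X
  obtain ⟨x, y, hxy⟩ : ∃ x y : X, y ∉ MulAction.orbit K x := by
    by_contra! h
    exact hK ⟨fun x y => h x y⟩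
  let A := MulAction.orbit K x
  let c : ℂ := ∑ z : X, if z ∈ A then 1 else 0
  have : Nonempty X := ⟨x⟩
  have hn : (Fintype.card X : ℂ) ≠ 0 := Nat.cast_ne_zero.2 Fintype.card_ne_zero
  let f : X → ℂ := fun z => (Fintype.card X : ℂ) * (if z ∈ A then 1 else 0) - c
  have hf : f ∈ augSubmodule X := by
    rw [mem_augSubmodule]
    simp only [f, Finset.sum_sub_distrib, ← Finset.mul_sum, Finset.sum_const, Finset.card_univ,
      nsmul_eq_mul]
    exact sub_self _
  refine ⟨⟨f, hf⟩, ?_, ?_⟩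
  · intro h0
    have h : ∀ z, f z = 0 := fun z => congrArg (fun f : augSubmodule X => f.1 z) h0
    have hx : x ∈ A := MulAction.mem_orbit_self x
    have h1 := h x
    have h2 := h y
    simp only [f, hx, A, hxy, if_true, if_false, mul_one, mul_zero, zero_sub, neg_eq_zero] at h1 h2
    rw [h2, sub_zero] at h1
    exact hn h1
  · intro g hg
    ext z
    have hz : g⁻¹ • z ∈ A ↔ z ∈ A := by
      rw [← MulAction.orbit_eq_iff, ← MulAction.orbit_eq_iff,
        ← MulAction.orbit_smul (⟨g, hg⟩ : K)⁻¹ z]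
      rfl
    simp only [augRep_apply, f, hz]

/-- If `G` acts transitively on `X`, so does any subgroup of index coprime to the cardinality
of `X`. -/
lemma isPretransitive_of_coprime_index {G X : Type*} [Group G] [Finite G] [MulAction G X]
    [MulAction.IsPretransitive G X] [Finite X] [Nonempty X] (K : Subgroup G)
    (h : (Nat.card X).Coprime K.index) : MulAction.IsPretransitive K X := by
  obtain ⟨x⟩ := ‹Nonempty X›
  let S := MulAction.stabilizer G x
  have hS : S.index = Nat.card X := MulAction.index_stabilizer_of_transitive G x
  have hcard : (MulAction.orbit K x).ncard = S.relIndex K := by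
    rw [← MulAction.index_stabilizer]
    rfl
  have hdvd : Nat.card X ∣ S.relIndex K := by
    refine h.dvd_of_dvd_mul_right ?_
    rw [← hS, ← Subgroup.inf_relIndex_right, Subgroup.relIndex_mul_index inf_le_right]
    exact Subgroup.index_dvd_of_le inf_le_left
  refine (MulAction.isPretransitive_iff_orbit_eq_univ x).2 ?_
  refine Set.eq_of_subset_of_ncard_le (Set.subset_univ _) ?_
  rw [hcard, Set.ncard_univ]
  exact Nat.le_of_dvd (Nat.pos_of_ne_zero Subgroup.index_ne_zero_of_finite) hdvd

lemma dvd_alphaChar_augRep_iff (G X : Type*) [Group G] [Finite G] [MulAction G X]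
    [MulAction.IsPretransitive G X] [Finite X] [Nonempty X] {p : ℕ} (hp : p.Prime) :
    p ∣ alphaChar (augRep G X) ↔ ∃ k, Nat.card X = p ^ k := by
  have : Fact p.Prime := ⟨hp⟩
  rw [dvd_alphaChar_iff]
  constructor
  · intro h
    let Q : Sylow p G := default
    by_cases hQ : MulAction.IsPretransitive (Q : Subgroup G) X
    · obtain ⟨x⟩ := ‹Nonempty X›
      obtain ⟨n, hn⟩ := Q.2.exists_card_eq
      have hdvd : Nat.card X ∣ p ^ n := by
        rw [← hn, ← MulAction.index_stabilizer_of_transitive (Q : Subgroup G) x]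
        exact Subgroup.index_dvd_card _
      obtain ⟨k, -, hk⟩ := (Nat.dvd_prime_pow hp).1 hdvd
      exact ⟨k, hk⟩
    · obtain ⟨f, hf0, hf⟩ := exists_fixed_of_not_isPretransitive _ hQ
      obtain ⟨K, hK, hcard⟩ := exists_subgroup_index_eq_orbitCard (augRep G X) f
      have hle : (Q : Subgroup G) ≤ K := fun g hg => (hK g).2 (hf g hg)
      have hdvd := h f hf0
      rw [hcard] at hdvd
      exact absurd (hdvd.trans (Subgroup.index_dvd_of_le hle)) Q.not_dvd_index
  · rintro ⟨k, hk⟩ f hf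
    by_contra hdvd
    obtain ⟨K, hK, hcard⟩ := exists_subgroup_index_eq_orbitCard (augRep G X) f
    rw [hcard] at hdvd
    have hco : (Nat.card X).Coprime K.index := by
      rw [hk]
      exact ((Nat.Prime.coprime_iff_not_dvd hp).2 hdvd).pow_left k
    have := isPretransitive_of_coprime_index K hco
    exact hf (eq_zero_of_isPretransitive K f fun g hg => (hK g).1 hg)

lemma nontrivial_augSubmodule (X : Type*) [Finite X] [Nontrivial X] :
    Nontrivial (augSubmodule X) := by
  have hX : ¬ MulAction.IsPretransitive (⊥ : Subgroup (Equiv.Perm X)) X := by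
    intro h
    obtain ⟨x, y, hxy⟩ := exists_pair_ne X
    obtain ⟨g, hg⟩ := MulAction.exists_smul_eq (⊥ : Subgroup (Equiv.Perm X)) x y
    rw [Subsingleton.elim g 1, one_smul] at hg
    exact hxy hg
  obtain ⟨f, hf, -⟩ := exists_fixed_of_not_isPretransitive _ hX
  exact ⟨f, 0, hf⟩

end AlphaChar

open AlphaChar in
/-- for a proper subgroup H of a finite group G and the augmentation
module V of the left-translation action of G on G/H, α(V) > 1 iff [G:H] is a prime
power; and if [G:H] is a power of a prime p, then p divides α(V). -/
theorem alphaChar_augRep_coset {G : Type} [Group G] [Finite G]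
    (H : Subgroup G) (hH : H ≠ ⊤) :
    (1 < alphaChar (augRep G (G ⧸ H)) ↔ IsPrimePow H.index) ∧
    (∀ (p k : ℕ), p.Prime → H.index = p ^ k → p ∣ alphaChar (augRep G (G ⧸ H))) := by
  have hindex : H.index ≠ 1 := fun h => hH (Subgroup.index_eq_one.1 h)
  refine ⟨⟨fun h => ?_, fun h => ?_⟩, fun p k hp hk => (dvd_alphaChar_augRep_iff G (G ⧸ H) hp).2 ⟨k, hk⟩⟩
  · obtain ⟨p, hp, hdvd⟩ := Nat.exists_prime_and_dvd h.ne'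
    obtain ⟨k, hk⟩ := (dvd_alphaChar_augRep_iff G (G ⧸ H) hp).1 hdvd
    refine (isPrimePow_nat_iff _).2 ⟨p, k, hp, Nat.pos_of_ne_zero ?_, hk.symm⟩
    rintro rfl
    exact hindex hk
  · obtain ⟨p, k, hp, -, hk⟩ := (isPrimePow_nat_iff _).1 h
    have hdvd := (dvd_alphaChar_augRep_iff G (G ⧸ H) hp).2 ⟨k, hk.symm⟩
    have : Nontrivial (G ⧸ H) := QuotientGroup.nontrivial_iff.2 hH
    have := nontrivial_augSubmodule (G ⧸ H)
    exact hp.one_lt.trans_le (Nat.le_of_dvd (Nat.pos_of_ne_zero (alphaChar_ne_zero _)) hdvd)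
end
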